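/- Let φ be a function of class C⁹ on a neighborhood U of the origin in ℝ² with φ(0) = 0 and all partial derivatives of order ≤ 2 of φ vanishing at the origin, and let p₃ and p₄ be the third and fourth Taylor homogeneous parts of φ at the origin. Then the following are equivalent: (i) φ has a singularity of type E₇ at the origin; (ii) there exist a nonzero real constant c and a nonzero linear form ℓ on ℝ² with p₃ = c·ℓ³, and ℓ divides p₄ while ℓ² does not divide p₄. -/

import Mathlib

open Set MvPolynomial

/-- The mixed partial derivative `∂₁^i ∂₂^j φ (0,0)`. -/
noncomputable def mixedPartial (φ : ℝ × ℝ → ℝ) (i j : ℕ) : ℝ :=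
  iteratedDeriv i (fun s => iteratedDeriv j (fun t => φ (s, t)) 0) 0

/-- `φ` (with domain `U`, a neighborhood of the origin) has a singularity of type `E₇`
at the origin: there are a neighborhood `V` of `0` and a `C¹` map `ϕ` with `ϕ 0 = 0`,
`ϕ '' V ⊆ U` and nonzero Jacobian determinant at `0`, with
`φ (ϕ y) = y₂·y₁³ + y₂³` on `V`. -/
def HasE7 (φ : ℝ × ℝ → ℝ) (U : Set (ℝ × ℝ)) : Prop :=
  ∃ V ∈ nhds (0 : ℝ × ℝ), ∃ ϕ : ℝ × ℝ → ℝ × ℝ,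
    ContDiffOn ℝ 1 ϕ V ∧ ϕ 0 = 0 ∧ ϕ '' V ⊆ U ∧
    LinearMap.det ((fderiv ℝ ϕ 0) : (ℝ × ℝ) →ₗ[ℝ] ℝ × ℝ) ≠ 0 ∧
    ∀ y ∈ V, φ (ϕ y) = y.2 * y.1 ^ 3 + y.2 ^ 3

universe u

/-- Differentiation under the integral sign, in the `C^n` class. -/
theorem contDiff_intervalIntegral_of_contDiff {E G : Type u}
    [NormedAddCommGroup E] [NormedSpace ℝ E] [ProperSpace E]
    [NormedAddCommGroup G] [NormedSpace ℝ G] [CompleteSpace G] {F : E × ℝ → G} {n : ℕ}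
    (hF : ContDiff ℝ n F) (a b : ℝ) :
    ContDiff ℝ n (fun x => ∫ t in a..b, F (x, t)) := by
  induction n generalizing G with
  | zero =>
    rw [Nat.cast_zero, contDiff_zero] at hF ⊢
    exact intervalIntegral.continuous_parametric_intervalIntegral_of_continuous' (f := fun x t => F (x, t)) hF a b
  | succ n ih =>
    have hd : Differentiable ℝ F := hF.differentiable (by simp)
    have hF' : ContDiff ℝ n (fun z : E × ℝ => (fderiv ℝ F z).comp (.inl ℝ E ℝ)) :=
      (hF.fderiv_right le_rfl).clm_comp contDiff_const
    have key : ∀ x, HasFDerivAt (fun x => ∫ t in a..b, F (x, t))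
        (∫ t in a..b, (fderiv ℝ F (x, t)).comp (.inl ℝ E ℝ)) x := by
      intro x
      obtain ⟨C, hC⟩ := ((isCompact_closedBall x 1).prod isCompact_uIcc).exists_bound_of_continuousOn
        (f := fun z : E × ℝ => (fderiv ℝ F z).comp (.inl ℝ E ℝ)) (s := Metric.closedBall x 1 ×ˢ uIcc a b)
        hF'.continuous.continuousOn
      refine intervalIntegral.hasFDerivAt_integral_of_dominated_of_fderiv_le
        (F := fun x t => F (x, t)) (F' := fun x t => (fderiv ℝ F (x, t)).comp (.inl ℝ E ℝ))
        (bound := fun _ => C)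
        (Metric.closedBall_mem_nhds x one_pos) ?_ ?_ ?_ ?_ ?_ ?_
      · exact .of_forall fun y => (hF.continuous.comp (by fun_prop)).aestronglyMeasurable
      · exact (hF.continuous.comp (by fun_prop)).intervalIntegrable _ _
      · exact (hF'.continuous.comp (by fun_prop)).aestronglyMeasurable
      · exact .of_forall fun t ht y hy => hC (y, t) ⟨hy, uIoc_subset_uIcc ht⟩
      · exact intervalIntegrable_const
      · refine .of_forall fun t ht y hy => ?_
        exact (hd (y, t)).hasFDerivAt.comp y (hasFDerivAt_prodMk_left y t)
    push_cast
    rw [contDiff_succ_iff_fderiv]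
    refine ⟨fun x => (key x).differentiableAt, by simp, ?_⟩
    rw [funext fun x => (key x).fderiv]
    exact ih hF'

/-- Hadamard's lemma in the second variable. -/
theorem exists_contDiff_eq_add_mul {F : ℝ × ℝ → ℝ} {n : ℕ} (hF : ContDiff ℝ (n + 1 : ℕ) F) :
    ∃ h : ℝ × ℝ → ℝ, ContDiff ℝ n h ∧ ∀ x y, F (x, y) = F (x, 0) + y * h (x, y) := by
  have hF' : ContDiff ℝ n (fun z : (ℝ × ℝ) × ℝ => fderiv ℝ F (z.1.1, z.2 * z.1.2) (0, 1)) := by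
    have h1 : ContDiff ℝ n (fderiv ℝ F) := hF.fderiv_right le_rfl
    exact (h1.comp (by fun_prop)).clm_apply contDiff_const
  refine ⟨_, contDiff_intervalIntegral_of_contDiff hF' 0 1, fun x y => ?_⟩
  have hd : ∀ t ∈ uIcc (0 : ℝ) 1, HasDerivAt (fun t : ℝ => F (x, t * y))
      (y * fderiv ℝ F (x, t * y) (0, 1)) t := by
    intro t _
    have h1 : HasDerivAt (fun t : ℝ => (x, t * y)) ((0 : ℝ), y) t :=
      (hasDerivAt_const t x).prodMk (by simpa using (hasDerivAt_id t).mul_const y)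
    have h2 := ((hF.differentiable (by simp)) (x, t * y)).hasFDerivAt.comp_hasDerivAt t h1
    rwa [show ((0 : ℝ), y) = y • ((0 : ℝ), (1 : ℝ)) by simp, map_smul, smul_eq_mul] at h2
  have := intervalIntegral.integral_eq_sub_of_hasDerivAt hd
    (Continuous.intervalIntegrable (by
      have := hF'.continuous
      exact continuous_const.mul (this.comp (by fun_prop : Continuous fun t : ℝ => ((x, y), t)))) _ _)
  rw [intervalIntegral.integral_const_mul] at this
  simp only [one_mul, zero_mul] at this
  linarith

theorem iteratedDeriv_succ_id_mul_zero {g : ℝ → ℝ} {j : ℕ} (hg : ContDiff ℝ (j + 1 : ℕ) g) :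
    iteratedDeriv (j + 1) (fun t => t * g t) 0 = (j + 1) * iteratedDeriv j g 0 := by
  have h := iteratedDeriv_mul (n := j + 1) (x := (0 : ℝ)) (f := fun t : ℝ => t) (g := g)
    contDiff_id.contDiffAt hg.contDiffAt
  have h' : ((fun t : ℝ => t) * g) = fun t => t * g t := rfl
  rw [h'] at h
  rw [h, Finset.sum_eq_single 1]
  · simp [iteratedDeriv_one]
  · intro i _ hi
    rw [iteratedDeriv_fun_id_zero]
    simp [hi]
  · simp

/-- Taylor expansion in the second variable with a smooth parameter and a smooth remainder. -/
theorem exists_taylor_snd (m n : ℕ) {F : ℝ × ℝ → ℝ} (hF : ContDiff ℝ (n + m : ℕ) F) :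
    ∃ (g : ℕ → ℝ → ℝ) (h : ℝ × ℝ → ℝ), ContDiff ℝ n h ∧
      (∀ j < m, ContDiff ℝ (n + (m - j) : ℕ) (g j) ∧
        ∀ x, iteratedDeriv j (fun t => F (x, t)) 0 = j.factorial * g j x) ∧
      ∀ x y, F (x, y) = ∑ j ∈ Finset.range m, y ^ j * g j x + y ^ m * h (x, y) := by
  induction m generalizing F with
  | zero => exact ⟨fun _ _ => 0, F, hF, by simp, by simp⟩
  | succ m ih =>
    obtain ⟨H, hH, hHF⟩ := exists_contDiff_eq_add_mul (n := n + m) hF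
    obtain ⟨g, h, hh, hg, hHg⟩ := ih hH
    refine ⟨fun j => Nat.casesOn j (fun x => F (x, 0)) g, h, hh, ?_, ?_⟩
    · rintro (_ | j) hj
      · exact ⟨hF.comp (by fun_prop), by simp⟩
      · have hj' : j < m := by omega
        refine ⟨by simpa using (hg j hj').1, fun x => ?_⟩
        have hc : ContDiff ℝ (n + m : ℕ) (fun t => H (x, t)) := hH.comp (by fun_prop)
        rw [funext (hHF x), iteratedDeriv_const_add (by omega), iteratedDeriv_succ_id_mul_zero
          (hc.of_le (by exact_mod_cast (by omega : j + 1 ≤ n + m))), (hg j hj').2, Nat.factorial_succ]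
        push_cast
        ring
    · intro x y
      rw [hHF, hHg, Finset.sum_range_succ', mul_add, Finset.mul_sum]
      simp only [pow_succ]
      simp only [pow_zero, one_mul]
      rw [add_comm (F (x,0)), add_right_comm]
      congr 1
      · congr 1
        exact Finset.sum_congr rfl fun j _ => by ring
      · ring

/-- Taylor expansion of order `m` at the origin of `ℝ²` with remainder in Hadamard form. -/
theorem exists_taylor_prod (m n : ℕ) {f : ℝ × ℝ → ℝ} (hf : ContDiff ℝ (n + m : ℕ) f) :
    ∃ H : ℕ → ℝ × ℝ → ℝ, (∀ j, ContDiff ℝ n (H j)) ∧ ∀ x y, f (x, y) =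
      ∑ j ∈ Finset.range m, ∑ i ∈ Finset.range (m - j),
        mixedPartial f i j / (i.factorial * j.factorial) * x ^ i * y ^ j +
      ∑ j ∈ Finset.range (m + 1), x ^ (m - j) * y ^ j * H j (x, y) := by
  obtain ⟨g, h, hh, hg, hf'⟩ := exists_taylor_snd m n hf
  have key : ∀ j, ∃ k : ℝ → ℝ, ContDiff ℝ n k ∧ (j < m → ∀ x, g j x =
      ∑ i ∈ Finset.range (m - j), mixedPartial f i j / (i.factorial * j.factorial) * x ^ i +
        x ^ (m - j) * k x) := by
    intro j
    by_cases hj : j < m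
    · obtain ⟨g', k, hk, hg', hgk⟩ := exists_taylor_snd (m - j) n
        (F := fun z => g j z.2) ((hg j hj).1.comp contDiff_snd)
      refine ⟨fun x => k (0, x), hk.comp (by fun_prop), fun _ x => ?_⟩
      rw [hgk 0 x]
      congr 1
      refine Finset.sum_congr rfl fun i hi => ?_
      have h1 := (hg' i (Finset.mem_range.1 hi)).2 0
      have h2 : mixedPartial f i j = j.factorial * (i.factorial * g' i 0) := by
        rw [mixedPartial, funext (hg j hj).2, iteratedDeriv_const_mul_field, ← h1]
      rw [h2]
      field_simp
    · exact ⟨fun _ => 0, contDiff_const, fun h => absurd h hj⟩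
  choose k hk hgk using key
  refine ⟨fun j => if j < m then fun z => k j z.1 else h, fun j => ?_, fun x y => ?_⟩
  · dsimp only
    split_ifs
    · exact (hk j).comp contDiff_fst
    · exact hh
  · rw [hf', Finset.sum_range_succ _ m, ← add_assoc, ← Finset.sum_add_distrib]
    congr 1
    · refine Finset.sum_congr rfl fun j hj => ?_
      have hj := Finset.mem_range.1 hj
      rw [hgk j hj, mul_add, Finset.mul_sum]
      simp only [if_pos hj]
      congr 1
      · exact Finset.sum_congr rfl fun i _ => by ring
      · ring
    · simp

theorem mixedPartial_congr {f g : ℝ × ℝ → ℝ} (h : f =ᶠ[nhds 0] g) (i j : ℕ) :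
    mixedPartial f i j = mixedPartial g i j := by
  have h0 : ∀ᶠ s in nhds (0 : ℝ), (fun t => f (s, t)) =ᶠ[nhds 0] fun t => g (s, t) :=
    Filter.Eventually.curry_nhds (p := fun z => f z = g z) h
  refine Filter.EventuallyEq.iteratedDeriv_eq i ?_
  filter_upwards [h0] with s hs using hs.iteratedDeriv_eq j

/-- A germ of a `C^n` function has a global `C^n` representative. -/
theorem exists_contDiff_eventuallyEq {E : Type*} [NormedAddCommGroup E] [NormedSpace ℝ E]
    [HasContDiffBump E] [FiniteDimensional ℝ E] {U : Set E} {x : E} (hU : U ∈ nhds x)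
    {φ : E → ℝ} {n : ℕ} (hφ : ContDiffOn ℝ n φ U) :
    ∃ f : E → ℝ, ContDiff ℝ n f ∧ f =ᶠ[nhds x] φ := by
  obtain ⟨ε, hε, hεU⟩ := Metric.mem_nhds_iff.1 hU
  let χ : ContDiffBump x := ⟨ε / 4, ε / 2, by linarith, by linarith⟩
  refine ⟨fun z => χ z * φ z, ?_, ?_⟩
  · rw [contDiff_iff_contDiffAt]
    intro z
    by_cases hz : z ∈ Metric.ball x ε
    · exact χ.contDiff.contDiffAt.mul
        (hφ.contDiffAt (Filter.mem_of_superset (Metric.isOpen_ball.mem_nhds hz) hεU))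
    · have hz' : z ∉ tsupport χ := by
        rw [χ.tsupport_eq]
        intro h
        have : dist z x ≤ ε / 2 := h
        exact hz (Metric.mem_ball.2 (by linarith))
      have : (fun z => χ z * φ z) =ᶠ[nhds z] fun _ => 0 := by
        filter_upwards [notMem_tsupport_iff_eventuallyEq.1 hz'] with w hw
        simp [hw]
      exact contDiffAt_const.congr_of_eventuallyEq this
  · filter_upwards [χ.eventuallyEq_one] with z hz
    simp [hz]

/-- A product of `m` linear forms in two variables is a binary form of degree `m`. -/
theorem exists_coeff_pow_mul_pow (α β γ δ : ℝ) (i j : ℕ) :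
    ∃ c : ℕ → ℝ, ∀ X Y : ℝ, (α * X + β * Y) ^ i * (γ * X + δ * Y) ^ j =
      ∑ k ∈ Finset.range (i + j + 1), c k * (X ^ (i + j - k) * Y ^ k) := by
  have step : ∀ (a b : ℝ) (n : ℕ) (P : ℝ → ℝ → ℝ),
      (∃ c : ℕ → ℝ, ∀ X Y, P X Y = ∑ k ∈ Finset.range (n + 1), c k * (X ^ (n - k) * Y ^ k)) →
      ∃ c : ℕ → ℝ, ∀ X Y, (a * X + b * Y) * P X Y =
        ∑ k ∈ Finset.range (n + 1 + 1), c k * (X ^ (n + 1 - k) * Y ^ k) := by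
    rintro a b n P ⟨c, hc⟩
    refine ⟨fun k => a * (if k < n + 1 then c k else 0) + b * (if k = 0 then 0 else c (k - 1)), fun X Y => ?_⟩
    simp only [add_mul, Finset.sum_add_distrib]
    rw [Finset.sum_range_succ, Finset.sum_range_succ' _ (n + 1), hc, Finset.mul_sum,
      Finset.mul_sum]
    simp only [lt_irrefl, if_false, mul_zero, zero_mul, add_zero, Nat.add_sub_add_right,
      if_true, Nat.add_one_ne_zero, Nat.add_sub_cancel]
    congr 1
    · refine Finset.sum_congr rfl fun k hk => ?_
      have hk := Finset.mem_range.1 hk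
      rw [if_pos hk, show n + 1 - k = n - k + 1 by omega]
      ring
    · exact Finset.sum_congr rfl fun k _ => by ring
  induction i with
  | zero =>
    induction j with
    | zero => exact ⟨fun _ => 1, by simp⟩
    | succ j ih =>
      obtain ⟨c, hc⟩ := step γ δ _ _ ih
      refine ⟨c, fun X Y => ?_⟩
      rw [← add_assoc, ← hc]
      ring
  | succ i ih =>
    obtain ⟨c, hc⟩ := step α β _ _ ih
    refine ⟨c, fun X Y => ?_⟩
    rw [add_right_comm i 1 j, ← hc]
    ring

/-- Linear substitution in a binary form. -/
theorem exists_matrix_sum_pow_mul_pow (α β γ δ : ℝ) (n : ℕ) :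
    ∃ M : ℕ → ℕ → ℝ, ∀ (h : ℕ → ℝ) (X Y : ℝ),
      ∑ j ∈ Finset.range (n + 1), (α * X + β * Y) ^ (n - j) * (γ * X + δ * Y) ^ j * h j =
        ∑ k ∈ Finset.range (n + 1), X ^ (n - k) * Y ^ k *
          ∑ j ∈ Finset.range (n + 1), M k j * h j := by
  choose c hc using fun j => exists_coeff_pow_mul_pow α β γ δ (n - j) j
  refine ⟨fun k j => c j k, fun h X Y => ?_⟩
  simp only [Finset.mul_sum]
  rw [Finset.sum_comm]
  refine Finset.sum_congr rfl fun j hj => ?_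
  have : n - j + j = n := by have := Finset.mem_range.1 hj; omega
  rw [hc, Finset.sum_mul, this]
  exact Finset.sum_congr rfl fun k _ => by ring

/-- The fourth order Taylor expansion of `φ` in linear coordinates. -/
theorem exists_jet_expansion {U : Set (ℝ × ℝ)} (hU : U ∈ nhds (0 : ℝ × ℝ))
    {φ : ℝ × ℝ → ℝ} (hφ : ContDiffOn ℝ 6 φ U)
    (hcrit : ∀ i j : ℕ, i + j ≤ 2 → mixedPartial φ i j = 0)
    {p3 p4 : MvPolynomial (Fin 2) ℝ}
    (hp3 : p3 = ∑ i ∈ Finset.range 4,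
      C (mixedPartial φ i (3 - i) / (Nat.factorial i * Nat.factorial (3 - i))) *
        X 0 ^ i * X 1 ^ (3 - i))
    (hp4 : p4 = ∑ i ∈ Finset.range 5,
      C (mixedPartial φ i (4 - i) / (Nat.factorial i * Nat.factorial (4 - i))) *
        X 0 ^ i * X 1 ^ (4 - i)) (α β γ δ : ℝ) :
    ∃ (c d : ℕ → ℝ) (H : ℕ → ℝ × ℝ → ℝ), (∀ j, ContDiff ℝ 1 (H j)) ∧
      (∀ x y, eval ![α * x + β * y, γ * x + δ * y] p3 =
        ∑ k ∈ Finset.range 4, x ^ (3 - k) * y ^ k * c k) ∧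
      (∀ x y, eval ![α * x + β * y, γ * x + δ * y] p4 =
        ∑ k ∈ Finset.range 5, x ^ (4 - k) * y ^ k * d k) ∧
      ∀ᶠ z in nhds (0 : ℝ × ℝ), φ (α * z.1 + β * z.2, γ * z.1 + δ * z.2) =
        ∑ k ∈ Finset.range 4, z.1 ^ (3 - k) * z.2 ^ k * c k +
        ∑ k ∈ Finset.range 5, z.1 ^ (4 - k) * z.2 ^ k * d k +
        ∑ k ∈ Finset.range 6, z.1 ^ (5 - k) * z.2 ^ k * H k z := by
  obtain ⟨f, hf, hfφ⟩ := exists_contDiff_eventuallyEq (n := 6) hU (by exact_mod_cast hφ)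
  obtain ⟨H, hH, hfH⟩ := exists_taylor_prod 5 1 hf
  simp only [mixedPartial_congr hfφ] at hfH
  have hjet : ∀ x y, f (x, y) = eval ![x, y] p3 + eval ![x, y] p4 +
      ∑ j ∈ Finset.range 6, x ^ (5 - j) * y ^ j * H j (x, y) := by
    intro x y
    rw [hfH, hp3, hp4]
    simp only [Finset.sum_range_succ, Finset.sum_range_zero, Nat.reduceSub, hcrit 0 0 (by simp),
      hcrit 0 1 (by simp), hcrit 0 2 (by simp), hcrit 1 0 (by simp), hcrit 1 1 (by simp),
      hcrit 2 0 (by simp), map_add, map_mul, map_pow, eval_C, eval_X, map_zero,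
      Matrix.cons_val_zero, Matrix.cons_val_one]
    ring
  obtain ⟨M3, hM3⟩ := exists_matrix_sum_pow_mul_pow α β γ δ 3
  obtain ⟨M4, hM4⟩ := exists_matrix_sum_pow_mul_pow α β γ δ 4
  obtain ⟨M5, hM5⟩ := exists_matrix_sum_pow_mul_pow α β γ δ 5
  have h3 := fun x y : ℝ => Eq.trans (a := eval ![α * x + β * y, γ * x + δ * y] p3) (by
    rw [hp3]
    simp only [Finset.sum_range_succ, Finset.sum_range_zero, Nat.reduceSub, map_add, map_mul,
      map_pow, eval_C, eval_X, map_zero, Matrix.cons_val_zero, Matrix.cons_val_one]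
    ring) (hM3 (fun j => mixedPartial φ (3 - j) j / (Nat.factorial (3 - j) * Nat.factorial j)) x y)
  have h4 := fun x y : ℝ => Eq.trans (a := eval ![α * x + β * y, γ * x + δ * y] p4) (by
    rw [hp4]
    simp only [Finset.sum_range_succ, Finset.sum_range_zero, Nat.reduceSub, map_add, map_mul,
      map_pow, eval_C, eval_X, map_zero, Matrix.cons_val_zero, Matrix.cons_val_one]
    ring) (hM4 (fun j => mixedPartial φ (4 - j) j / (Nat.factorial (4 - j) * Nat.factorial j)) x y)
  refine ⟨_, _, fun k z => ∑ j ∈ Finset.range 6,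
    M5 k j * H j (α * z.1 + β * z.2, γ * z.1 + δ * z.2), fun k => ?_, h3, h4, ?_⟩
  · refine ContDiff.sum fun j _ => contDiff_const.mul ((hH j).comp ?_)
    fun_prop
  · have hlim : Filter.Tendsto (fun z : ℝ × ℝ => (α * z.1 + β * z.2, γ * z.1 + δ * z.2))
        (nhds 0) (nhds 0) := by
      have : Continuous (fun z : ℝ × ℝ => (α * z.1 + β * z.2, γ * z.1 + δ * z.2)) := by fun_prop
      exact this.tendsto' 0 0 (by simp)
    filter_upwards [hlim.eventually hfφ] with z hz
    rw [← hz, hjet, h3, h4, hM5 (fun j => H j (α * z.1 + β * z.2, γ * z.1 + δ * z.2))]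

theorem exists_equiv_of_injective {E : Type*} [NormedAddCommGroup E] [NormedSpace ℝ E]
    [FiniteDimensional ℝ E] {L : E →L[ℝ] E} (hL : ∀ v, L v = 0 → v = 0) :
    ∃ e : E ≃L[ℝ] E, (e : E →L[ℝ] E) = L := by
  have hinj : Function.Injective (L : E →ₗ[ℝ] E) := (injective_iff_map_eq_zero _).2 hL
  exact ⟨(LinearEquiv.ofInjectiveEndo _ hinj).toContinuousLinearEquiv, by ext v; rfl⟩

theorem HasFDerivAt.exists_equiv_of_injective {E : Type*} [NormedAddCommGroup E]
    [NormedSpace ℝ E] [FiniteDimensional ℝ E] {f : E → E} {L : E →L[ℝ] E} {x : E}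
    (hf : HasFDerivAt f L x) (hL : ∀ v, L v = 0 → v = 0) :
    ∃ e : E ≃L[ℝ] E, HasFDerivAt f (e : E →L[ℝ] E) x := by
  obtain ⟨e, rfl⟩ := _root_.exists_equiv_of_injective hL
  exact ⟨e, hf⟩

theorem exists_pow_three_eq (c : ℝ) : ∃ w : ℝ, w ^ 3 = c := by
  rcases le_total 0 c with h | h
  · exact ⟨c ^ ((3 : ℕ) : ℝ)⁻¹, Real.rpow_inv_natCast_pow h (by norm_num)⟩
  · refine ⟨-(-c) ^ ((3 : ℕ) : ℝ)⁻¹, ?_⟩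
    rw [Odd.neg_pow (by decide), Real.rpow_inv_natCast_pow (by linarith) (by norm_num), neg_neg]

/-- The algebraic system governing the change of coordinates `(x β + y γ, y w + x² s)` which
carries `y x³ + y³` to `x⁵ e + x³ y b + x² y² q + y³ r` has a `C¹` solution. -/
theorem exists_contDiffAt_solution {e b q r : ℝ × ℝ → ℝ}
    (he : ContDiff ℝ 1 e) (hb : ContDiff ℝ 1 b) (hq : ContDiff ℝ 1 q) (hr : ContDiff ℝ 1 r)
    (hb0 : b 0 ≠ 0) (hr0 : r 0 ≠ 0) :
    ∃ u : ℝ × ℝ → ℝ × ℝ × ℝ × ℝ, ContDiffAt ℝ 1 u 0 ∧ (u 0).1 ≠ 0 ∧ (u 0).2.2.1 ≠ 0 ∧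
      ∀ᶠ z in nhds (0 : ℝ × ℝ),
        (u z).1 ^ 3 * (u z).2.2.2 + z.1 * (u z).2.2.2 ^ 3 = e z ∧
        (u z).2.2.1 * (u z).1 ^ 3 + z.1 * (3 * ((u z).2.2.2 * (u z).1 ^ 2 * (u z).2.1)) +
          z.1 * (3 * ((u z).2.2.1 * (u z).2.2.2 ^ 2)) = b z ∧
        3 * ((u z).2.2.1 * (u z).1 ^ 2 * (u z).2.1) +
          z.1 * (3 * ((u z).2.2.2 * (u z).1 * (u z).2.1 ^ 2)) +
          3 * ((u z).2.2.1 ^ 2 * (u z).2.2.2) = q z ∧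
        (u z).2.2.1 ^ 3 + z.1 * (3 * ((u z).2.2.1 * (u z).1 * (u z).2.1 ^ 2)) +
          z.2 * ((u z).2.2.1 * (u z).2.1 ^ 3) +
          z.1 ^ 2 * ((u z).2.2.2 * (u z).2.1 ^ 3) = r z := by
  obtain ⟨w, hw⟩ := exists_pow_three_eq (r 0)
  have hw0 : w ≠ 0 := by rintro rfl; apply hr0; rw [← hw]; norm_num
  obtain ⟨β, hβ⟩ := exists_pow_three_eq (b 0 / w)
  have hβ0 : β ≠ 0 := by
    rintro rfl
    exact div_ne_zero hb0 hw0 (by rw [← hβ]; norm_num)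
  set s : ℝ := e 0 / β ^ 3 with hs
  set γ : ℝ := (q 0 - 3 * (w ^ 2 * s)) / (3 * (w * β ^ 2)) with hγ
  let G : (ℝ × ℝ) × (ℝ × ℝ × ℝ × ℝ) → ℝ × ℝ × ℝ × ℝ := fun p =>
    (p.2.1 ^ 3 * p.2.2.2.2 + p.1.1 * p.2.2.2.2 ^ 3 - e p.1,
     p.2.2.2.1 * p.2.1 ^ 3 + p.1.1 * (3 * (p.2.2.2.2 * p.2.1 ^ 2 * p.2.2.1)) +
          p.1.1 * (3 * (p.2.2.2.1 * p.2.2.2.2 ^ 2)) - b p.1,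
     3 * (p.2.2.2.1 * p.2.1 ^ 2 * p.2.2.1) +
          p.1.1 * (3 * (p.2.2.2.2 * p.2.1 * p.2.2.1 ^ 2)) +
          3 * (p.2.2.2.1 ^ 2 * p.2.2.2.2) - q p.1,
     p.2.2.2.1 ^ 3 + p.1.1 * (3 * (p.2.2.2.1 * p.2.1 * p.2.2.1 ^ 2)) +
          p.1.2 * (p.2.2.2.1 * p.2.2.1 ^ 3) +
          p.1.1 ^ 2 * (p.2.2.2.2 * p.2.2.1 ^ 3) - r p.1)
  have hG : ContDiff ℝ 1 G := by
    have he' : ContDiff ℝ 1 (fun p : (ℝ × ℝ) × (ℝ × ℝ × ℝ × ℝ) => e p.1) := he.comp contDiff_fst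
    have hb' : ContDiff ℝ 1 (fun p : (ℝ × ℝ) × (ℝ × ℝ × ℝ × ℝ) => b p.1) := hb.comp contDiff_fst
    have hq' : ContDiff ℝ 1 (fun p : (ℝ × ℝ) × (ℝ × ℝ × ℝ × ℝ) => q p.1) := hq.comp contDiff_fst
    have hr' : ContDiff ℝ 1 (fun p : (ℝ × ℝ) × (ℝ × ℝ × ℝ × ℝ) => r p.1) := hr.comp contDiff_fst
    fun_prop
  let u₀ : ℝ × ℝ × ℝ × ℝ := (β, γ, w, s)
  have hG0 : G (0, u₀) = 0 := by
    have h1 : β ^ 3 * s = e 0 := by rw [hs]; field_simp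
    have h2 : w * β ^ 3 = b 0 := by rw [hβ]; field_simp
    have h3 : 3 * (w * β ^ 2 * γ) + 3 * (w ^ 2 * s) = q 0 := by rw [hγ]; field_simp; ring
    simp only [G, u₀, Prod.fst_zero, Prod.snd_zero]
    ext <;> simp <;> linarith
  have hinv : (fderiv ℝ G (0, u₀) ∘L .inr ℝ (ℝ × ℝ) (ℝ × ℝ × ℝ × ℝ)).IsInvertible := by
    have h1 : HasFDerivAt (fun v => G (0, v))
        (fderiv ℝ G (0, u₀) ∘L .inr ℝ (ℝ × ℝ) (ℝ × ℝ × ℝ × ℝ)) u₀ :=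
      ((hG.differentiable one_ne_zero) (0, u₀)).hasFDerivAt.comp u₀ (hasFDerivAt_prodMk_right 0 u₀)
    have d1 : HasFDerivAt (fun v : ℝ × ℝ × ℝ × ℝ => v.1) (.fst ℝ ℝ (ℝ × ℝ × ℝ)) u₀ := hasFDerivAt_fst
    have d2 : HasFDerivAt (fun v : ℝ × ℝ × ℝ × ℝ => v.2.1)
        (.fst ℝ ℝ (ℝ × ℝ) ∘L .snd ℝ ℝ (ℝ × ℝ × ℝ)) u₀ :=
      (ContinuousLinearMap.fst ℝ ℝ (ℝ × ℝ) ∘L .snd ℝ ℝ (ℝ × ℝ × ℝ)).hasFDerivAt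
    have d3 : HasFDerivAt (fun v : ℝ × ℝ × ℝ × ℝ => v.2.2.1)
        (.fst ℝ ℝ ℝ ∘L .snd ℝ ℝ (ℝ × ℝ) ∘L .snd ℝ ℝ (ℝ × ℝ × ℝ)) u₀ :=
      (ContinuousLinearMap.fst ℝ ℝ ℝ ∘L .snd ℝ ℝ (ℝ × ℝ) ∘L .snd ℝ ℝ (ℝ × ℝ × ℝ)).hasFDerivAt
    have d4 : HasFDerivAt (fun v : ℝ × ℝ × ℝ × ℝ => v.2.2.2)
        (.snd ℝ ℝ ℝ ∘L .snd ℝ ℝ (ℝ × ℝ) ∘L .snd ℝ ℝ (ℝ × ℝ × ℝ)) u₀ :=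
      (ContinuousLinearMap.snd ℝ ℝ ℝ ∘L .snd ℝ ℝ (ℝ × ℝ) ∘L .snd ℝ ℝ (ℝ × ℝ × ℝ)).hasFDerivAt
    have h2 := (((d1.pow 3).mul d4).sub_const (e 0)).prodMk
      (((d3.mul (d1.pow 3)).sub_const (b 0)).prodMk
      ((((((d3.mul (d1.pow 2)).mul d2).const_mul 3).add
        (((d3.pow 2).mul d4).const_mul 3)).sub_const (q 0)).prodMk
      ((d3.pow 3).sub_const (r 0))))
    have h3 : (fun v => G (0, v)) = fun v : ℝ × ℝ × ℝ × ℝ => (v.1 ^ 3 * v.2.2.2 - e 0,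
        v.2.2.1 * v.1 ^ 3 - b 0, 3 * (v.2.2.1 * v.1 ^ 2 * v.2.1) +
        3 * (v.2.2.1 ^ 2 * v.2.2.2) - q 0, v.2.2.1 ^ 3 - r 0) := by
      funext v
      simp [G]
    rw [h3] at h1
    rw [h1.unique h2]
    refine exists_equiv_of_injective fun v hv => ?_
    obtain ⟨v1, v2, v3, v4⟩ := v
    simp [u₀] at hv
    obtain ⟨e1, e2, e3, e4⟩ := hv
    obtain rfl : v3 = 0 := e4.resolve_left hw0
    obtain rfl : v1 = 0 := by simpa [hw0, hβ0] using e2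
    obtain rfl : v4 = 0 := by simpa [hβ0] using e1
    obtain rfl : v2 = 0 := by simpa [hw0, hβ0] using e3
    rfl
  have hGat := hG.contDiffAt (x := ((0 : ℝ × ℝ), u₀))
  have hval : hGat.implicitFunction one_ne_zero hinv 0 = u₀ :=
    hGat.implicitFunction_apply_self one_ne_zero hinv
  refine ⟨hGat.implicitFunction one_ne_zero hinv,
    hGat.contDiffAt_implicitFunction one_ne_zero hinv, ?_, ?_, ?_⟩
  · rw [hval]
    exact hβ0
  · rw [hval]
    exact hw0
  · filter_upwards [hGat.eventually_apply_implicitFunction one_ne_zero hinv] with z hz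
    rw [hG0] at hz
    simp only [G, Prod.ext_iff, Prod.fst_zero, Prod.snd_zero, sub_eq_zero] at hz
    exact hz

/-- The normal form of an `E₇` singularity. -/
theorem exists_normalizing_map {f e b q r : ℝ × ℝ → ℝ}
    (he : ContDiff ℝ 1 e) (hb : ContDiff ℝ 1 b) (hq : ContDiff ℝ 1 q) (hr : ContDiff ℝ 1 r)
    (hb0 : b 0 ≠ 0) (hr0 : r 0 ≠ 0)
    (hf : ∀ᶠ z in nhds (0 : ℝ × ℝ), f z =
      z.1 ^ 5 * e z + z.1 ^ 3 * z.2 * b z + z.1 ^ 2 * z.2 ^ 2 * q z + z.2 ^ 3 * r z) :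
    ∃ (ϕ : ℝ × ℝ → ℝ × ℝ) (L : (ℝ × ℝ) ≃L[ℝ] ℝ × ℝ), ContDiffAt ℝ 1 ϕ 0 ∧ ϕ 0 = 0 ∧
      HasFDerivAt ϕ (L : (ℝ × ℝ) →L[ℝ] ℝ × ℝ) 0 ∧
      ∀ᶠ y in nhds (0 : ℝ × ℝ), f (ϕ y) = y.2 * y.1 ^ 3 + y.2 ^ 3 := by
  obtain ⟨u, hu, hβ0, hw0, hsol⟩ := exists_contDiffAt_solution he hb hq hr hb0 hr0
  let Ψ : ℝ × ℝ → ℝ × ℝ := fun z =>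
    (z.1 * (u z).1 + z.2 * (u z).2.1, z.2 * (u z).2.2.1 + z.1 ^ 2 * (u z).2.2.2)
  have hΨ : ContDiffAt ℝ 1 Ψ 0 := by fun_prop
  have hΨ0 : Ψ 0 = 0 := by simp [Ψ]
  have hdu := (hu.differentiableAt one_ne_zero).hasFDerivAt
  have d1 : HasFDerivAt (fun z : ℝ × ℝ => z.1) (.fst ℝ ℝ ℝ) 0 := hasFDerivAt_fst
  have d2 : HasFDerivAt (fun z : ℝ × ℝ => z.2) (.snd ℝ ℝ ℝ) 0 := hasFDerivAt_snd
  have u1 := hdu.fst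
  have u2 := hdu.snd.fst
  have u3 := hdu.snd.snd.fst
  have u4 := hdu.snd.snd.snd
  have hd := ((d1.mul u1).add (d2.mul u2)).prodMk ((d2.mul u3).add ((d1.pow 2).mul u4))
  obtain ⟨L, hd⟩ := hd.exists_equiv_of_injective (fun v hv => by
    obtain ⟨v1, v2⟩ := v
    simp at hv
    obtain ⟨e1, e2⟩ := hv
    obtain rfl : v2 = 0 := e2.resolve_left hw0
    obtain rfl : v1 = 0 := by simpa [hβ0] using e1
    rfl)
  replace hd : HasFDerivAt Ψ (L : (ℝ × ℝ) →L[ℝ] ℝ × ℝ) 0 := hd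
  have hs := hΨ.hasStrictFDerivAt' hd one_ne_zero
  have hinv := hΨ.to_localInverse hd one_ne_zero
  have hinv0 := hΨ.localInverse_apply_image hd one_ne_zero
  have hder := hs.to_localInverse.hasFDerivAt
  have hright := hs.eventually_right_inverse
  rw [hΨ0] at hinv hinv0 hder hright
  refine ⟨hΨ.localInverse hd one_ne_zero, L.symm, hinv, hinv0, hder, ?_⟩
  have hlim : Filter.Tendsto (hΨ.localInverse hd one_ne_zero) (nhds 0) (nhds 0) := by
    have := hinv.continuousAt.tendsto
    rwa [hinv0] at this
  filter_upwards [hright, hlim.eventually hf, hlim.eventually hsol] with y hy hfy hsy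
  replace hy : Ψ (hΨ.localInverse hd one_ne_zero y) = y := hy
  set z := hΨ.localInverse hd one_ne_zero y
  obtain ⟨s1, s2, s3, s4⟩ := hsy
  rw [hfy, ← hy, ← s1, ← s2, ← s3, ← s4]
  simp only [Ψ]
  ring

/-- A normalizing map in linear coordinates yields an `E₇` singularity. -/
theorem hasE7_of_linear_comp {U : Set (ℝ × ℝ)} (hU : U ∈ nhds (0 : ℝ × ℝ)) {φ : ℝ × ℝ → ℝ}
    {α β γ δ : ℝ} (hD : α * δ - β * γ ≠ 0) {ϕ : ℝ × ℝ → ℝ × ℝ} {L : (ℝ × ℝ) ≃L[ℝ] ℝ × ℝ}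
    (hϕ : ContDiffAt ℝ 1 ϕ 0) (hϕ0 : ϕ 0 = 0) (hL : HasFDerivAt ϕ (L : (ℝ × ℝ) →L[ℝ] ℝ × ℝ) 0)
    (h : ∀ᶠ y in nhds (0 : ℝ × ℝ), φ (α * (ϕ y).1 + β * (ϕ y).2, γ * (ϕ y).1 + δ * (ϕ y).2) =
      y.2 * y.1 ^ 3 + y.2 ^ 3) : HasE7 φ U := by
  let ψ : ℝ × ℝ → ℝ × ℝ := fun y => (α * (ϕ y).1 + β * (ϕ y).2, γ * (ϕ y).1 + δ * (ϕ y).2)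
  have hψ : ContDiffAt ℝ 1 ψ 0 := by fun_prop
  have hψ0 : ψ 0 = 0 := by simp [ψ, hϕ0]
  have hψd := ((hL.fst.const_mul α).add (hL.snd.const_mul β)).prodMk
    ((hL.fst.const_mul γ).add (hL.snd.const_mul δ))
  obtain ⟨e, hψd⟩ := hψd.exists_equiv_of_injective (fun v hv => by
    simp at hv
    obtain ⟨h1, h2⟩ := hv
    have k1 : (L v).1 = 0 := by
      have : (α * δ - β * γ) * (L v).1 = 0 := by linear_combination δ * h1 - β * h2
      simpa [hD] using this
    have k2 : (L v).2 = 0 := by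
      have : (α * δ - β * γ) * (L v).2 = 0 := by linear_combination α * h2 - γ * h1
      simpa [hD] using this
    exact (map_eq_zero_iff L L.injective).1 (Prod.ext k1 k2))
  replace hψd : HasFDerivAt ψ (e : (ℝ × ℝ) →L[ℝ] ℝ × ℝ) 0 := hψd
  obtain ⟨V, hV, hVc⟩ := hψ.contDiffOn le_rfl (by simp)
  have hlim : ∀ᶠ y in nhds 0, ψ y ∈ U := hψ.continuousAt.eventually_mem (by rwa [hψ0])
  refine ⟨V ∩ ({y | ψ y ∈ U} ∩ {y | ψ y ∈ U → φ (ψ y) = y.2 * y.1 ^ 3 + y.2 ^ 3}),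
    Filter.inter_mem hV (Filter.inter_mem hlim (h.mono fun y hy _ => hy)), ψ,
    hVc.mono inter_subset_left, hψ0, ?_, ?_, fun y hy => hy.2.2 hy.2.1⟩
  · rintro _ ⟨y, hy, rfl⟩
    exact hy.2.1
  · rw [hψd.fderiv]
    exact (LinearEquiv.isUnit_det' e.toLinearEquiv).ne_zero

theorem hasE7_of_factorization {U : Set (ℝ × ℝ)} (hU : U ∈ nhds (0 : ℝ × ℝ))
    {φ : ℝ × ℝ → ℝ} (hφ : ContDiffOn ℝ 6 φ U)
    (hcrit : ∀ i j : ℕ, i + j ≤ 2 → mixedPartial φ i j = 0)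
    {p3 p4 : MvPolynomial (Fin 2) ℝ}
    (hp3 : p3 = ∑ i ∈ Finset.range 4,
      C (mixedPartial φ i (3 - i) / (Nat.factorial i * Nat.factorial (3 - i))) *
        X 0 ^ i * X 1 ^ (3 - i))
    (hp4 : p4 = ∑ i ∈ Finset.range 5,
      C (mixedPartial φ i (4 - i) / (Nat.factorial i * Nat.factorial (4 - i))) *
        X 0 ^ i * X 1 ^ (4 - i))
    {c a b : ℝ} (hc : c ≠ 0) (hab : (a, b) ≠ (0, 0))
    (h3 : p3 = C c * (C a * X 0 + C b * X 1) ^ 3) (h4 : C a * X 0 + C b * X 1 ∣ p4)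
    (h4' : ¬ (C a * X 0 + C b * X 1) ^ 2 ∣ p4) : HasE7 φ U := by
  have hN : a ^ 2 + b ^ 2 ≠ 0 := by
    contrapose! hab
    have ha : a = 0 := by nlinarith [sq_nonneg a, sq_nonneg b]
    have hb : b = 0 := by nlinarith [sq_nonneg a, sq_nonneg b]
    simp [ha, hb]
  set N := a ^ 2 + b ^ 2 with hNdef
  obtain ⟨k, d, H, hH, e3, e4, hexp⟩ := exists_jet_expansion hU hφ hcrit hp3 hp4
    (-b / N) (a / N) (a / N) (b / N)
  have hl : ∀ x y : ℝ, a * (-b / N * x + a / N * y) + b * (a / N * x + b / N * y) = y := by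
    intro x y
    field_simp
    rw [hNdef]
    ring
  have h3' : ∀ x y : ℝ, c * y ^ 3 = ∑ j ∈ Finset.range 4, x ^ (3 - j) * y ^ j * k j := by
    intro x y
    rw [← e3, h3]
    simp [hl]
  simp only [Finset.sum_range_succ, Finset.sum_range_zero] at h3' e4 hexp
  have k0 : k 0 = 0 := by simpa using (h3' 1 0).symm
  have k3 : k 3 = c := by simpa using (h3' 0 1).symm
  have hk1 := h3' 1 1
  have hk2 := h3' 1 (-1)
  norm_num [k0, k3] at hk1 hk2
  have k1 : k 1 = 0 := by linarith
  have k2 : k 2 = 0 := by linarith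
  have d0 : d 0 = 0 := by
    obtain ⟨g, hg⟩ := h4
    have := e4 1 0
    rw [hg] at this
    simp at this
    have h0 : a * (-b / N) + b * (a / N) = 0 := by simpa using hl 1 0
    simpa [h0] using this.symm
  have d1 : d 1 ≠ 0 := by
    intro d1
    apply h4'
    refine ⟨C (d 2) * (C (-b) * X 0 + C a * X 1) ^ 2 +
      C (d 3) * ((C (-b) * X 0 + C a * X 1) * (C a * X 0 + C b * X 1)) +
      C (d 4) * (C a * X 0 + C b * X 1) ^ 2, ?_⟩
    refine MvPolynomial.funext fun v => ?_
    have := e4 (-b * v 0 + a * v 1) (a * v 0 + b * v 1)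
    have hv : ![-b / N * (-b * v 0 + a * v 1) + a / N * (a * v 0 + b * v 1),
        a / N * (-b * v 0 + a * v 1) + b / N * (a * v 0 + b * v 1)] = v := by
      ext i
      fin_cases i
      · simp
        field_simp
        rw [hNdef]; ring
      · simp
        field_simp
        rw [hNdef]; ring
    rw [hv] at this
    rw [this, d0, d1]
    simp
    ring
  obtain ⟨ϕ, L, hϕ, hϕ0, hL, hE⟩ := exists_normalizing_map (e := H 0)
    (f := fun z => φ (-b / N * z.1 + a / N * z.2, a / N * z.1 + b / N * z.2))
    (b := fun z => d 1 + z.1 * H 1 z) (q := fun z => d 2 + z.1 * H 2 z)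
    (r := fun z => c + d 3 * z.1 + d 4 * z.2 + z.1 ^ 2 * H 3 z + z.1 * z.2 * H 4 z +
      z.2 ^ 2 * H 5 z)
    (hH 0) (by have := hH 1; fun_prop) (by have := hH 2; fun_prop)
    (by have := hH 3; have := hH 4; have := hH 5; fun_prop) (by simpa using d1) (by simpa using hc)
    (by
      filter_upwards [hexp] with z hz
      rw [hz, k0, k1, k2, k3, d0]
      ring)
  refine hasE7_of_linear_comp hU ?_ hϕ hϕ0 hL hE
  have : -b / N * (b / N) - a / N * (a / N) = -1 / N := by
    field_simp
    rw [hNdef]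
    ring
  rw [this]
  exact div_ne_zero (by norm_num) hN

theorem tendsto_div_of_hasFDerivAt {ϕ : ℝ × ℝ → ℝ × ℝ} (hϕ0 : ϕ 0 = 0)
    (hϕ : HasFDerivAt ϕ (.id ℝ (ℝ × ℝ)) 0) (v : ℝ × ℝ) :
    Filter.Tendsto (fun t : ℝ => (ϕ (t • v)).1 / t) (nhdsWithin 0 {0}ᶜ) (nhds v.1) ∧
    Filter.Tendsto (fun t : ℝ => (ϕ (t • v)).2 / t) (nhdsWithin 0 {0}ᶜ) (nhds v.2) := by
  have h1 : HasDerivAt (fun t : ℝ => ϕ (t • v)) v 0 := by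
    have h2 : HasDerivAt (fun t : ℝ => t • v) v 0 := by
      simpa using (hasDerivAt_id (0 : ℝ)).smul_const v
    have h3 : HasFDerivAt ϕ (.id ℝ (ℝ × ℝ)) ((0 : ℝ) • v) := by rwa [zero_smul]
    exact h3.comp_hasDerivAt (0 : ℝ) h2
  have h2 := hasDerivAt_iff_tendsto_slope_zero.1 h1
  simp only [zero_add, zero_smul, hϕ0, sub_zero] at h2
  refine ⟨?_, ?_⟩
  · refine ((continuous_fst.tendsto v).comp h2).congr fun t => ?_
    simp [div_eq_inv_mul]
  · refine ((continuous_snd.tendsto v).comp h2).congr fun t => ?_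
    simp [div_eq_inv_mul]

/-- The cubic part of a function which is carried to the `E₇` normal form by a map tangent to the
identity. -/
theorem cubic_part_eq {c d : ℕ → ℝ} {H : ℕ → ℝ × ℝ → ℝ} (hH : ∀ j, ContDiff ℝ 1 (H j))
    {ϕ : ℝ × ℝ → ℝ × ℝ} (hϕ0 : ϕ 0 = 0) (hϕ : HasFDerivAt ϕ (.id ℝ (ℝ × ℝ)) 0)
    (h : ∀ᶠ y in nhds (0 : ℝ × ℝ),
      ∑ k ∈ Finset.range 4, (ϕ y).1 ^ (3 - k) * (ϕ y).2 ^ k * c k +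
        ∑ k ∈ Finset.range 5, (ϕ y).1 ^ (4 - k) * (ϕ y).2 ^ k * d k +
        ∑ k ∈ Finset.range 6, (ϕ y).1 ^ (5 - k) * (ϕ y).2 ^ k * H k (ϕ y) =
      y.2 * y.1 ^ 3 + y.2 ^ 3) (v : ℝ × ℝ) :
    ∑ k ∈ Finset.range 4, v.1 ^ (3 - k) * v.2 ^ k * c k = v.2 ^ 3 := by
  obtain ⟨hX, hY⟩ := tendsto_div_of_hasFDerivAt hϕ0 hϕ v
  have ht : Filter.Tendsto (fun t : ℝ => t) (nhdsWithin 0 {0}ᶜ) (nhds 0) :=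
    tendsto_nhdsWithin_of_tendsto_nhds Filter.tendsto_id
  have htv : Filter.Tendsto (fun t : ℝ => t • v) (nhdsWithin 0 {0}ᶜ) (nhds 0) := by
    simpa using ht.smul_const v
  have hz : Filter.Tendsto (fun t : ℝ => ϕ (t • v)) (nhdsWithin 0 {0}ᶜ) (nhds 0) := by
    have := hϕ.continuousAt.tendsto
    rw [hϕ0] at this
    exact this.comp htv
  have hHt : ∀ k, Filter.Tendsto (fun t : ℝ => H k (ϕ (t • v))) (nhdsWithin 0 {0}ᶜ)
      (nhds (H k 0)) := fun k => ((hH k).continuous.tendsto 0).comp hz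
  have hL := ((tendsto_finsetSum (Finset.range 4) fun k _ =>
      ((hX.pow (3 - k)).mul (hY.pow k)).mul_const (c k)).add
    (ht.mul (tendsto_finsetSum (Finset.range 5) fun k _ =>
      ((hX.pow (4 - k)).mul (hY.pow k)).mul_const (d k)))).add
    ((ht.pow 2).mul (tendsto_finsetSum (Finset.range 6) fun k _ =>
      ((hX.pow (5 - k)).mul (hY.pow k)).mul (hHt k)))
  have hR := (ht.mul_const (v.2 * v.1 ^ 3)).add_const (v.2 ^ 3)
  simp only [zero_mul, add_zero, ne_eq, OfNat.ofNat_ne_zero, not_false_eq_true, zero_pow,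
    zero_add] at hL hR
  refine tendsto_nhds_unique_of_eventuallyEq hL hR ?_
  filter_upwards [htv.eventually h, self_mem_nhdsWithin] with t hE ht0
  replace ht0 : t ≠ 0 := ht0
  simp only [Finset.sum_range_succ, Finset.sum_range_zero, Prod.smul_fst, Prod.smul_snd,
    smul_eq_mul] at hE ⊢
  refine mul_left_cancel₀ (pow_ne_zero 3 ht0) ?_
  simp only [Nat.sub_zero, Nat.sub_self, Nat.reduceSub, pow_zero, zero_add, one_mul, mul_one] at hE ⊢
  have : t ^ 3 * (t * (v.2 * v.1 ^ 3) + v.2 ^ 3) = t * v.2 * (t * v.1) ^ 3 + (t * v.2) ^ 3 := by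
    ring
  rw [this, ← hE]
  field_simp

/-- The quartic part of a function which is carried to the `E₇` normal form by a map tangent to
the identity. -/
theorem quartic_part {d₀ : ℝ} {e b q r : ℝ × ℝ → ℝ}
    (he : ContDiff ℝ 1 e) (hb : ContDiff ℝ 1 b) (hq : ContDiff ℝ 1 q) (hr : ContDiff ℝ 1 r)
    (hr0 : r 0 ≠ 0) {ϕ : ℝ × ℝ → ℝ × ℝ} (hϕ : ContDiffAt ℝ 1 ϕ 0) (hϕ0 : ϕ 0 = 0)
    (hϕd : HasFDerivAt ϕ (.id ℝ (ℝ × ℝ)) 0)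
    (h : ∀ᶠ y in nhds (0 : ℝ × ℝ),
      (ϕ y).1 ^ 4 * d₀ + (ϕ y).1 ^ 5 * e (ϕ y) + (ϕ y).1 ^ 3 * (ϕ y).2 * b (ϕ y) +
        (ϕ y).1 ^ 2 * (ϕ y).2 ^ 2 * q (ϕ y) + (ϕ y).2 ^ 3 * r (ϕ y) =
      y.2 * y.1 ^ 3 + y.2 ^ 3) : d₀ = 0 ∧ b 0 ≠ 0 := by
  obtain ⟨hX, hY⟩ := tendsto_div_of_hasFDerivAt hϕ0 hϕd (1, 0)
  set l : Filter ℝ := nhdsWithin 0 {0}ᶜ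
  have ht : Filter.Tendsto (fun t : ℝ => t) l (nhds 0) :=
    tendsto_nhdsWithin_of_tendsto_nhds Filter.tendsto_id
  have htv : Filter.Tendsto (fun t : ℝ => t • ((1, 0) : ℝ × ℝ)) l (nhds 0) := by
    simpa using ht.smul_const ((1, 0) : ℝ × ℝ)
  have hz : Filter.Tendsto (fun t : ℝ => ϕ (t • (1, 0))) l (nhds 0) := by
    have := hϕd.continuousAt.tendsto
    rw [hϕ0] at this
    exact this.comp htv
  have hw : Filter.Tendsto (fun t : ℝ => fderiv ℝ ϕ (t • (1, 0)) (0, 1)) l (nhds (0, 1)) := by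
    have h1 : ContinuousAt (fderiv ℝ ϕ) 0 :=
      (hϕ.fderiv_right (m := 0) (by simp)).continuousAt
    have h2 : Filter.Tendsto (fun t : ℝ => fderiv ℝ ϕ (t • (1, 0))) l
        (nhds (.id ℝ (ℝ × ℝ))) := hϕd.fderiv ▸ h1.tendsto.comp htv
    exact (isBoundedBilinearMap_apply.continuous.tendsto _).comp
      (h2.prodMk_nhds (tendsto_const_nhds (x := ((0, 1) : ℝ × ℝ))))
  have hw1 : Filter.Tendsto (fun t : ℝ => (fderiv ℝ ϕ (t • (1, 0)) (0, 1)).1) l (nhds 0) :=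
    (continuous_fst.tendsto _).comp hw
  have hw2 : Filter.Tendsto (fun t : ℝ => (fderiv ℝ ϕ (t • (1, 0)) (0, 1)).2) l (nhds 1) :=
    (continuous_snd.tendsto _).comp hw
  have hlim : ∀ {g : ℝ × ℝ → ℝ}, ContDiff ℝ 1 g →
      Filter.Tendsto (fun t : ℝ => g (ϕ (t • (1, 0)))) l (nhds (g 0)) :=
    fun hg => (hg.continuous.tendsto 0).comp hz
  have hlim' : ∀ {g : ℝ × ℝ → ℝ}, ContDiff ℝ 1 g →
      Filter.Tendsto (fun t : ℝ => fderiv ℝ g (ϕ (t • (1, 0))) (fderiv ℝ ϕ (t • (1, 0)) (0, 1))) l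
        (nhds (fderiv ℝ g 0 (0, 1))) :=
    fun {g} hg => by
      have h1 : Filter.Tendsto (fun t : ℝ => fderiv ℝ g (ϕ (t • (1, 0)))) l
        (nhds (fderiv ℝ g 0)) := ((hg.continuous_fderiv one_ne_zero).tendsto 0).comp hz
      exact (isBoundedBilinearMap_apply.continuous.tendsto _).comp (h1.prodMk_nhds hw)
  have hgrad : ∀ᶠ t in l, ∀ x y w₁ w₂, x = (ϕ (t • (1, 0))).1 → y = (ϕ (t • (1, 0))).2 →
      w₁ = (fderiv ℝ ϕ (t • (1, 0)) (0, 1)).1 → w₂ = (fderiv ℝ ϕ (t • (1, 0)) (0, 1)).2 →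
      4 * x ^ 3 * w₁ * d₀ + 5 * x ^ 4 * w₁ * e (ϕ (t • (1, 0))) +
        x ^ 5 * fderiv ℝ e (ϕ (t • (1, 0))) (fderiv ℝ ϕ (t • (1, 0)) (0, 1)) +
        (3 * x ^ 2 * w₁ * y + x ^ 3 * w₂) * b (ϕ (t • (1, 0))) +
        x ^ 3 * y * fderiv ℝ b (ϕ (t • (1, 0))) (fderiv ℝ ϕ (t • (1, 0)) (0, 1)) +
        (2 * x * w₁ * y ^ 2 + x ^ 2 * (2 * y * w₂)) * q (ϕ (t • (1, 0))) +
        x ^ 2 * y ^ 2 * fderiv ℝ q (ϕ (t • (1, 0))) (fderiv ℝ ϕ (t • (1, 0)) (0, 1)) +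
        3 * y ^ 2 * w₂ * r (ϕ (t • (1, 0))) +
        y ^ 3 * fderiv ℝ r (ϕ (t • (1, 0))) (fderiv ℝ ϕ (t • (1, 0)) (0, 1)) = t ^ 3 := by
    filter_upwards [htv.eventually h.eventually_nhds,
      htv.eventually (hϕ.eventually (by simp))] with t hEt hϕt
    rintro x y w₁ w₂ hx hy hw₁ hw₂
    let v : ℝ → ℝ × ℝ := fun s => t • (1, 0) + s • (0, 1)
    have hv : HasDerivAt v (0, 1) 0 := by
      have h1 := ((hasDerivAt_id (0 : ℝ)).smul_const ((0, 1) : ℝ × ℝ)).const_add (t • (1, 0))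
      rwa [one_smul] at h1
    have hv0 : v 0 = t • (1, 0) := by simp [v]
    have hg : HasDerivAt (fun s => ϕ (v s)) (fderiv ℝ ϕ (t • (1, 0)) (0, 1)) 0 := by
      have h1 := (hϕt.differentiableAt one_ne_zero).hasFDerivAt
      rw [← hv0] at h1
      have := h1.comp_hasDerivAt 0 hv
      rwa [hv0] at this
    have hcomp : ∀ {g : ℝ × ℝ → ℝ}, ContDiff ℝ 1 g → HasDerivAt (fun s => g (ϕ (v s)))
        (fderiv ℝ g (ϕ (t • (1, 0))) (fderiv ℝ ϕ (t • (1, 0)) (0, 1))) 0 := by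
      intro g hgd
      have h1 := (hgd.differentiable one_ne_zero (ϕ (v 0))).hasFDerivAt
      have := h1.comp_hasDerivAt 0 hg
      rwa [hv0] at this
    have hx' : HasDerivAt (fun s => (ϕ (v s)).1) w₁ 0 := hw₁ ▸ hg.fst
    have hy' : HasDerivAt (fun s => (ϕ (v s)).2) w₂ 0 := hw₂ ▸ hg.snd
    have hD := (((((hx'.pow 4).mul_const d₀).add ((hx'.pow 5).mul (hcomp he))).add
      (((hx'.pow 3).mul hy').mul (hcomp hb))).add
      (((hx'.pow 2).mul (hy'.pow 2)).mul (hcomp hq))).add ((hy'.pow 3).mul (hcomp hr))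
    have hE : HasDerivAt (fun s : ℝ => s * t ^ 3 + s ^ 3) (t ^ 3) 0 := by
      have h1 := ((hasDerivAt_id (0 : ℝ)).mul_const (t ^ 3)).add ((hasDerivAt_id (0 : ℝ)).pow 3)
      refine h1.congr_deriv ?_
      simp
    have hvc : Filter.Tendsto v (nhds 0) (nhds (t • (1, 0))) := by
      rw [← hv0]; exact hv.continuousAt
    have hEq := hE.unique (hD.congr_of_eventuallyEq (by
      filter_upwards [hvc.eventually hEt] with s hs
      simpa [v] using hs.symm))
    rw [hEq]
    simp [hv0, hx, hy]
    ring
  have hσ : Filter.Tendsto (fun t : ℝ => ((ϕ (t • (1, 0))).2 / t) ^ 2 / t) l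
      (nhds ((1 - b 0) / (3 * r 0))) := by
    have hA := (((((((((((hX.pow 3).mul hw1).const_mul 4).mul_const d₀).add
      ((((((hX.pow 4).mul ht).mul hw1).const_mul 5).mul (hlim he)))).add
      (((hX.pow 5).mul (ht.pow 2)).mul (hlim' he))).add
      (((((hX.pow 2).mul hw1).mul hY).const_mul 3).add ((hX.pow 3).mul hw2) |>.mul (hlim hb))).add
      ((((hX.pow 3).mul hY).mul ht).mul (hlim' hb))).add
      ((((((hX.mul hw1).mul (hY.pow 2)).const_mul 2).add
        ((((hX.pow 2).mul hY).mul hw2).const_mul 2)).mul (hlim hq)))).add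
      ((((hX.pow 2).mul (hY.pow 2)).mul ht).mul (hlim' hq))).add
      ((hY.pow 3).mul (hlim' hr)))
    have hden := ((hw2.mul (hlim hr)).const_mul 3)
    have hne : (3 : ℝ) * (1 * r 0) ≠ 0 := by simpa using hr0
    have hdiv := (hA.const_sub 1).div hden hne
    have hlim0 := hdiv.congr' (f₂ := fun t : ℝ => ((ϕ (t • (1, 0))).2 / t) ^ 2 / t) ?_
    · simpa using hlim0
    · filter_upwards [hgrad, self_mem_nhdsWithin, hden.eventually_ne hne] with t hgr ht0 hd0
      replace ht0 : t ≠ 0 := ht0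
      have := hgr _ _ _ _ rfl rfl rfl rfl
      rw [Pi.div_apply, div_eq_iff hd0]
      field_simp
      linear_combination -this
  have hval : ∀ᶠ t in l, ∀ ξ η, ξ = (ϕ (t • (1, 0))).1 / t → η = (ϕ (t • (1, 0))).2 / t →
      ξ ^ 4 * d₀ + t * ξ ^ 5 * e (ϕ (t • (1, 0))) + ξ ^ 3 * η * b (ϕ (t • (1, 0))) +
        ξ ^ 2 * η ^ 2 * q (ϕ (t • (1, 0))) + η * (η ^ 2 / t) * r (ϕ (t • (1, 0))) = 0 := by
    filter_upwards [htv.eventually h, self_mem_nhdsWithin] with t hEt ht0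
    replace ht0 : t ≠ 0 := ht0
    rintro ξ η rfl rfl
    refine mul_left_cancel₀ (pow_ne_zero 4 ht0) ?_
    simp only [Prod.smul_mk, smul_eq_mul, mul_zero, mul_one, zero_mul] at hEt
    simp only [Prod.smul_mk, smul_eq_mul, mul_zero, mul_one]
    rw [zero_pow three_ne_zero, add_zero] at hEt
    refine Eq.trans ?_ hEt
    field_simp
  have hd₀ : d₀ = 0 := by
    have hL := (((((hX.pow 4).mul_const d₀).add ((ht.mul (hX.pow 5)).mul (hlim he))).add
      (((hX.pow 3).mul hY).mul (hlim hb))).add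
      (((hX.pow 2).mul (hY.pow 2)).mul (hlim hq))).add ((hY.mul hσ).mul (hlim hr))
    have := tendsto_nhds_unique_of_eventuallyEq hL tendsto_const_nhds
      (hval.mono fun t ht => ht _ _ rfl rfl)
    simpa using this
  refine ⟨hd₀, fun hb0 => ?_⟩
  have hL := (((((hX.pow 5).mul hY).mul (hlim he)).add
      (((hX.pow 3).mul hσ).mul (hlim hb))).add
      ((((hX.pow 2).mul hY).mul hσ).mul (hlim hq))).add ((hσ.pow 2).mul (hlim hr))
  have := tendsto_nhds_unique_of_eventuallyEq hL (tendsto_const_nhds (x := (0 : ℝ))) (by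
    filter_upwards [hval, self_mem_nhdsWithin] with t hv ht0
    replace ht0 : t ≠ 0 := ht0
    have := hv _ _ rfl rfl
    rw [hd₀] at this
    refine mul_left_cancel₀ ht0 ?_
    refine Eq.trans ?_ ((mul_eq_zero_of_right ((ϕ (t • (1, 0))).2 / t) this).trans
      (mul_zero t).symm)
    field_simp
    ring)
  simp [hb0, hr0] at this

theorem factorization_of_hasE7 {U : Set (ℝ × ℝ)} (hU : U ∈ nhds (0 : ℝ × ℝ))
    {φ : ℝ × ℝ → ℝ} (hφ : ContDiffOn ℝ 6 φ U)
    (hcrit : ∀ i j : ℕ, i + j ≤ 2 → mixedPartial φ i j = 0)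
    {p3 p4 : MvPolynomial (Fin 2) ℝ}
    (hp3 : p3 = ∑ i ∈ Finset.range 4,
      C (mixedPartial φ i (3 - i) / (Nat.factorial i * Nat.factorial (3 - i))) *
        X 0 ^ i * X 1 ^ (3 - i))
    (hp4 : p4 = ∑ i ∈ Finset.range 5,
      C (mixedPartial φ i (4 - i) / (Nat.factorial i * Nat.factorial (4 - i))) *
        X 0 ^ i * X 1 ^ (4 - i))
    (h : HasE7 φ U) : ∃ a b : ℝ, (a, b) ≠ (0, 0) ∧ p3 = (C a * X 0 + C b * X 1) ^ 3 ∧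
      C a * X 0 + C b * X 1 ∣ p4 ∧ ¬ (C a * X 0 + C b * X 1) ^ 2 ∣ p4 := by
  obtain ⟨V, hV, ϕ, hϕV, hϕ0, -, hdet, hE⟩ := h
  have hϕ : ContDiffAt ℝ 1 ϕ 0 := hϕV.contDiffAt hV
  have hJ := (hϕ.differentiableAt one_ne_zero).hasFDerivAt
  set J := fderiv ℝ ϕ 0
  obtain ⟨α, hα⟩ : ∃ α, α = (J (1, 0)).1 := ⟨_, rfl⟩
  obtain ⟨β, hβ⟩ : ∃ β, β = (J (0, 1)).1 := ⟨_, rfl⟩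
  obtain ⟨γ, hγ⟩ : ∃ γ, γ = (J (1, 0)).2 := ⟨_, rfl⟩
  obtain ⟨δ, hδ⟩ : ∃ δ, δ = (J (0, 1)).2 := ⟨_, rfl⟩
  have hD : α * δ - β * γ ≠ 0 := by
    rw [← LinearMap.det_toMatrix (Module.Basis.finTwoProd ℝ), Matrix.det_fin_two] at hdet
    simpa [LinearMap.toMatrix_apply, ← hα, ← hβ, ← hγ, ← hδ] using hdet
  set D := α * δ - β * γ with hDdef
  let ψ : ℝ × ℝ → ℝ × ℝ := fun y =>
    (δ / D * (ϕ y).1 + -β / D * (ϕ y).2, -γ / D * (ϕ y).1 + α / D * (ϕ y).2)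
  have hψ : ContDiffAt ℝ 1 ψ 0 := by fun_prop
  have hψ0 : ψ 0 = 0 := by simp [ψ, hϕ0]
  have hψd : HasFDerivAt ψ (.id ℝ (ℝ × ℝ)) 0 := by
    refine (((hJ.fst.const_mul (δ / D)).add (hJ.snd.const_mul (-β / D))).prodMk
      ((hJ.fst.const_mul (-γ / D)).add (hJ.snd.const_mul (α / D)))).congr_fderiv ?_
    ext <;> simp [← hα, ← hβ, ← hγ, ← hδ] <;> field_simp <;> rw [hDdef] <;> ring
  obtain ⟨k, d, H, hH, e3, e4, hexp⟩ := exists_jet_expansion hU hφ hcrit hp3 hp4 α β γ δ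
  have hlim : Filter.Tendsto ψ (nhds 0) (nhds 0) := by
    have := hψ.continuousAt.tendsto
    rwa [hψ0] at this
  have hEψ : ∀ᶠ y in nhds (0 : ℝ × ℝ),
      ∑ j ∈ Finset.range 4, (ψ y).1 ^ (3 - j) * (ψ y).2 ^ j * k j +
        ∑ j ∈ Finset.range 5, (ψ y).1 ^ (4 - j) * (ψ y).2 ^ j * d j +
        ∑ j ∈ Finset.range 6, (ψ y).1 ^ (5 - j) * (ψ y).2 ^ j * H j (ψ y) =
      y.2 * y.1 ^ 3 + y.2 ^ 3 := by
    filter_upwards [hV, hlim.eventually hexp] with y hy hz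
    rw [← hz, ← hE y hy]
    congr 1
    ext
    · simp only [ψ]
      field_simp
      rw [hDdef]
      ring
    · simp only [ψ]
      field_simp
      rw [hDdef]
      ring
  have hcub := cubic_part_eq hH hψ0 hψd hEψ
  simp only [Finset.sum_range_succ, Finset.sum_range_zero] at e3 e4 hcub hEψ
  have k0 : k 0 = 0 := by simpa using hcub (1, 0)
  have k3 : k 3 = 1 := by simpa using hcub (0, 1)
  have hk1 := hcub (1, 1)
  have hk2 := hcub (1, -1)
  norm_num [k0, k3] at hk1 hk2
  have k1 : k 1 = 0 := by linarith
  have k2 : k 2 = 0 := by linarith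
  have hr0 : (1 : ℝ) + d 3 * (0 : ℝ × ℝ).1 + d 4 * (0 : ℝ × ℝ).2 +
      (0 : ℝ × ℝ).1 ^ 2 * H 3 0 + (0 : ℝ × ℝ).1 * (0 : ℝ × ℝ).2 * H 4 0 +
      (0 : ℝ × ℝ).2 ^ 2 * H 5 0 ≠ 0 := by simp
  obtain ⟨d0, d1⟩ := quartic_part (d₀ := d 0) (e := H 0)
    (b := fun z => d 1 + z.1 * H 1 z) (q := fun z => d 2 + z.1 * H 2 z)
    (r := fun z => 1 + d 3 * z.1 + d 4 * z.2 + z.1 ^ 2 * H 3 z + z.1 * z.2 * H 4 z +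
      z.2 ^ 2 * H 5 z)
    (hH 0) (by have := hH 1; fun_prop) (by have := hH 2; fun_prop)
    (by have := hH 3; have := hH 4; have := hH 5; fun_prop) hr0 hψ hψ0 hψd (by
      filter_upwards [hEψ] with y hy
      rw [← hy, k0, k1, k2, k3]
      ring)
  have hcoord : ∀ v : Fin 2 → ℝ, ![α * (δ / D * v 0 + -β / D * v 1) +
      β * (-γ / D * v 0 + α / D * v 1), γ * (δ / D * v 0 + -β / D * v 1) +
      δ * (-γ / D * v 0 + α / D * v 1)] = v := by
    intro v
    ext i
    fin_cases i
    · simp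
      field_simp
      rw [hDdef]
      ring
    · simp
      field_simp
      rw [hDdef]
      ring
  have hl : ∀ x y : ℝ, -γ / D * (α * x + β * y) + α / D * (γ * x + δ * y) = y := by
    intro x y
    field_simp
    rw [hDdef]
    ring
  refine ⟨-γ / D, α / D, ?_, ?_, ?_, ?_⟩
  · intro h0
    obtain ⟨h1, h2⟩ := Prod.mk.inj h0
    simp [hD] at h1 h2
    simp [h1, h2, hDdef] at hD
  · refine MvPolynomial.funext fun v => ?_
    have := e3 (δ / D * v 0 + -β / D * v 1) (-γ / D * v 0 + α / D * v 1)
    rw [hcoord, k0, k1, k2, k3] at this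
    simp [this]
  · refine ⟨C (d 1) * (C (δ / D) * X 0 + C (-β / D) * X 1) ^ 3 +
      C (d 2) * ((C (δ / D) * X 0 + C (-β / D) * X 1) ^ 2 *
        (C (-γ / D) * X 0 + C (α / D) * X 1)) +
      C (d 3) * ((C (δ / D) * X 0 + C (-β / D) * X 1) *
        (C (-γ / D) * X 0 + C (α / D) * X 1) ^ 2) +
      C (d 4) * (C (-γ / D) * X 0 + C (α / D) * X 1) ^ 3, ?_⟩
    refine MvPolynomial.funext fun v => ?_
    have := e4 (δ / D * v 0 + -β / D * v 1) (-γ / D * v 0 + α / D * v 1)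
    rw [hcoord, d0] at this
    rw [this]
    simp
    ring
  · rintro ⟨g, hg⟩
    have hgc : Continuous fun y : ℝ => eval ![α * 1 + β * y, γ * 1 + δ * y] g :=
      (MvPolynomial.continuous_eval g).comp (by fun_prop)
    have hEq : (fun y : ℝ => y * eval ![α * 1 + β * y, γ * 1 + δ * y] g) =
        fun y => d 1 + y * d 2 + y ^ 2 * d 3 + y ^ 3 * d 4 := by
      refine Continuous.ext_on (dense_compl_singleton (0 : ℝ)) (by fun_prop) (by fun_prop) ?_
      intro y hy
      refine mul_left_cancel₀ (show y ≠ 0 from hy) ?_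
      have := e4 1 y
      rw [hg, d0] at this
      simp only [map_mul, map_pow, map_add, eval_C, eval_X, Matrix.cons_val_zero,
        Matrix.cons_val_one, hl] at this
      linear_combination this
    have := congrFun hEq 0
    simp at this d1
    exact d1 this.symm

/-- invariant characterization of `E₇` type singularities for `C⁹` functions:
`φ` has an `E₇` singularity at the origin iff its third Taylor homogeneous part `p₃` is a
nonzero constant times the cube of a nonzero linear form `ℓ`, and `ℓ` divides the fourth
Taylor homogeneous part `p₄` while `ℓ²` does not divide `p₄` (divisibility in `ℝ[x₁,x₂]`). -/
theorem stmt_4 (U : Set (ℝ × ℝ)) (hU : U ∈ nhds (0 : ℝ × ℝ))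
    (φ : ℝ × ℝ → ℝ) (hφ : ContDiffOn ℝ 9 φ U) (hφ0 : φ 0 = 0)
    (hcrit : ∀ i j : ℕ, i + j ≤ 2 → mixedPartial φ i j = 0)
    (p3 p4 : MvPolynomial (Fin 2) ℝ)
    (hp3 : p3 = ∑ i ∈ Finset.range 4,
      C (mixedPartial φ i (3 - i) / (Nat.factorial i * Nat.factorial (3 - i))) *
        X 0 ^ i * X 1 ^ (3 - i))
    (hp4 : p4 = ∑ i ∈ Finset.range 5,
      C (mixedPartial φ i (4 - i) / (Nat.factorial i * Nat.factorial (4 - i))) *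
        X 0 ^ i * X 1 ^ (4 - i)) :
    HasE7 φ U ↔
      ∃ c : ℝ, c ≠ 0 ∧ ∃ ℓ : MvPolynomial (Fin 2) ℝ,
        (∃ a b : ℝ, (a, b) ≠ (0, 0) ∧ ℓ = C a * X 0 + C b * X 1) ∧
        p3 = C c * ℓ ^ 3 ∧ ℓ ∣ p4 ∧ ¬ (ℓ ^ 2 ∣ p4) := by
  have hφ6 : ContDiffOn ℝ 6 φ U := hφ.of_le (by norm_num)
  constructor
  · intro h
    obtain ⟨a, b, hab, h3, h4, h4'⟩ := factorization_of_hasE7 hU hφ6 hcrit hp3 hp4 h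
    exact ⟨1, one_ne_zero, _, ⟨a, b, hab, rfl⟩, by rw [h3, C_1, one_mul], h4, h4'⟩
  · rintro ⟨c, hc, _, ⟨a, b, hab, rfl⟩, h3, h4, h4'⟩
    exact hasE7_of_factorization hU hφ6 hcrit hp3 hp4 hc hab h3 h4 h4'
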